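/- arXiv:2410.06852 — 3 statements merged into one kernel-verified Lean document; each statement's English description precedes it below -/
import Mathlib

section
/- Let n, m be positive integers, let b : ℝⁿ → ℝ be differentiable, f : ℝⁿ → ℝⁿ, g : ℝⁿ → ℝ^{n×m}, let D ⊆ ℝⁿ, let U ⊆ ℝᵐ be a set of admissible controls, let α : ℝ → ℝ, and let d̄ ≥ 0. Define the Lie derivatives L_f b(x) = ⟨∇b(x), f(x)⟩ and L_g b(x) = g(x)ᵀ∇b(x) ∈ ℝᵐ. Suppose that for every x ∈ D there exists u ∈ U with L_f b(x) + ⟨L_g b(x), u⟩ - ‖L_g b(x)‖² ≥ -α(b(x)). Then for every x ∈ D and every disturbance μ ∈ ℝᵐ with ‖μ‖ ≤ d̄, there exists u ∈ U such that L_f b(x) + ⟨L_g b(x), u + μ⟩ ≥ -α(b(x)) - ‖μ‖²/4 ≥ -α(b(x)) - d̄²/4. -/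
open scoped RealInnerProductSpace

/-- `A · v` for a matrix `A ∈ ℝ^{n×m}` acting on `v ∈ ℝᵐ`, as Euclidean vectors. -/
noncomputable def matVec {n m : ℕ} (A : Matrix (Fin n) (Fin m) ℝ)
    (v : EuclideanSpace ℝ (Fin m)) : EuclideanSpace ℝ (Fin n) :=
  (EuclideanSpace.equiv (Fin n) ℝ).symm (A.mulVec (EuclideanSpace.equiv (Fin m) ℝ v))

/-- `Aᵀ · w` for a matrix `A ∈ ℝ^{n×m}` acting on `w ∈ ℝⁿ`, as Euclidean vectors. -/
noncomputable def matVecT {n m : ℕ} (A : Matrix (Fin n) (Fin m) ℝ)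
    (w : EuclideanSpace ℝ (Fin n)) : EuclideanSpace ℝ (Fin m) :=
  (EuclideanSpace.equiv (Fin m) ℝ).symm (A.transpose.mulVec (EuclideanSpace.equiv (Fin n) ℝ w))

/-- Completing the square: `‖v‖² + ⟨v, w⟩ ≥ -‖w‖²/4`. -/
theorem neg_norm_sq_div_four_le_norm_sq_add_inner {E : Type*} [NormedAddCommGroup E]
    [InnerProductSpace ℝ E] (v w : E) : -(‖w‖ ^ 2 / 4) ≤ ‖v‖ ^ 2 + ⟪v, w⟫ := by
  have h := neg_le_of_abs_le (abs_real_inner_le_norm v w)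
  nlinarith [sq_nonneg (‖v‖ - ‖w‖ / 2)]

/-- Theorem 1 of the paper: if the barrier condition with subtracted quadratic gain
`L_f b(x) + ⟨L_g b(x), u⟩ - ‖L_g b(x)‖² ≥ -α(b(x))` is feasible on `D`, then `b` is a robust
control barrier function: for every disturbance `μ` with `‖μ‖ ≤ dbar` there is an admissible
control `u` with `L_f b(x) + ⟨L_g b(x), u + μ⟩ ≥ -α(b(x)) - ‖μ‖²/4 ≥ -α(b(x)) - dbar²/4`. -/
theorem stmt_2 (n m : ℕ) (hn : 0 < n) (hm : 0 < m)
    (b : EuclideanSpace ℝ (Fin n) → ℝ) (hb : Differentiable ℝ b)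
    (f : EuclideanSpace ℝ (Fin n) → EuclideanSpace ℝ (Fin n))
    (g : EuclideanSpace ℝ (Fin n) → Matrix (Fin n) (Fin m) ℝ)
    (D : Set (EuclideanSpace ℝ (Fin n))) (U : Set (EuclideanSpace ℝ (Fin m)))
    (α : ℝ → ℝ) (dbar : ℝ) (hd : 0 ≤ dbar)
    (hfeas : ∀ x ∈ D, ∃ u ∈ U,
      ⟪gradient b x, f x⟫ + ⟪matVecT (g x) (gradient b x), u⟫
          - ‖matVecT (g x) (gradient b x)‖ ^ 2 ≥ -α (b x)) :
    ∀ x ∈ D, ∀ μ : EuclideanSpace ℝ (Fin m), ‖μ‖ ≤ dbar → ∃ u ∈ U,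
      ⟪gradient b x, f x⟫ + ⟪matVecT (g x) (gradient b x), u + μ⟫
          ≥ -α (b x) - ‖μ‖ ^ 2 / 4 ∧
      -α (b x) - ‖μ‖ ^ 2 / 4 ≥ -α (b x) - dbar ^ 2 / 4 := by
  intro x hx μ hμ
  obtain ⟨u, hu, h⟩ := hfeas x hx
  refine ⟨u, hu, ?_, ?_⟩
  · have key := neg_norm_sq_div_four_le_norm_sq_add_inner (matVecT (g x) (gradient b x)) μ
    rw [inner_add_right]
    linarith
  · have hsq : ‖μ‖ ^ 2 ≤ dbar ^ 2 := by gcongr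
    linarith
end

section
/- Let α : ℝ → ℝ be locally Lipschitz, strictly increasing, with α(0) = 0, let c ≥ 0, and let L ≤ 0 satisfy α(L) = -c. Let h : ℝ → ℝ be differentiable on [0, ∞) with h'(t) ≥ -α(h(t)) - c for all t ≥ 0. If h(0) ≥ L, then h(t) ≥ L for all t ≥ 0. -/
/-- Robust comparison lemma (Lemma 1): if `α` is a locally Lipschitz extended class-K function
(strictly increasing with `α(0) = 0`), `c ≥ 0`, `L ≤ 0` satisfies `α(L) = -c`, and `h` is
differentiable on `[0, ∞)` with `h'(t) ≥ -α(h(t)) - c` for all `t ≥ 0` and `h(0) ≥ L`, then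
`h(t) ≥ L` for all `t ≥ 0`. -/
theorem stmt_5 (α : ℝ → ℝ) (hlip : LocallyLipschitz α) (hmono : StrictMono α)
    (hα0 : α 0 = 0) (c : ℝ) (hc : 0 ≤ c) (L : ℝ) (hL : L ≤ 0) (hαL : α L = -c)
    (h h' : ℝ → ℝ)
    (hderiv : ∀ t ≥ (0 : ℝ), HasDerivAt h (h' t) t)
    (hineq : ∀ t ≥ (0 : ℝ), h' t ≥ -α (h t) - c)
    (hinit : h 0 ≥ L) :
    ∀ t ≥ (0 : ℝ), h t ≥ L := by
  intro t ht
  refine le_of_forall_pos_sub_le fun ε hε => ?_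
  have key := image_le_of_deriv_right_lt_deriv_boundary (f := fun x => -h x)
    (f' := fun x => -h' x) (a := 0) (b := t) (B := fun _ => -(L - ε)) (B' := fun _ => 0)
    (fun x hx => (hderiv x hx.1).continuousAt.neg.continuousWithinAt)
    (fun x hx => (hderiv x hx.1).neg.hasDerivWithinAt)
    (by linarith) (fun x => hasDerivAt_const x _)
    (fun x hx hxB => by
      have hlt : α (h x) < α L := hmono (by linarith)
      linarith [hineq x hx.1])
  linarith [key ⟨ht, le_rfl⟩]
end

section
/- Let n, m be positive integers, let b : ℝⁿ → ℝ be continuously differentiable, f : ℝⁿ → ℝⁿ and g : ℝⁿ → ℝ^{n×m} continuous, α : ℝ → ℝ locally Lipschitz, strictly increasing with α(0) = 0, and d̄ ≥ 0. Let x : [0,∞) → ℝⁿ be differentiable, u_s : [0,∞) → ℝᵐ, and μ : [0,∞) → ℝᵐ with ‖μ(t)‖ ≤ d̄ for all t ≥ 0, and suppose x solves ẋ(t) = f(x(t)) + g(x(t))·(u_s(t) + g(x(t))ᵀ∇b(x(t)) + μ(t)). Suppose that for every t ≥ 0 the barrier condition ⟨∇b(x(t)), f(x(t))⟩ + ⟨g(x(t))ᵀ∇b(x(t)),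 u_s(t)⟩ ≥ -α(b(x(t))) holds, and let L ≤ 0 satisfy α(L) = -d̄²/4. If b(x(0)) ≥ L, then b(x(t)) ≥ L for all t ≥ 0. -/
open scoped RealInnerProductSpace

theorem inner_matVec {n m : ℕ} (A : Matrix (Fin n) (Fin m) ℝ)
    (w : EuclideanSpace ℝ (Fin n)) (v : EuclideanSpace ℝ (Fin m)) :
    ⟪w, matVec A v⟫ = ⟪matVecT A w, v⟫ := by
  simp only [matVec, matVecT, EuclideanSpace.inner_eq_star_dotProduct, star_trivial,
    PiLp.continuousLinearEquiv_symm_apply, PiLp.coe_continuousLinearEquiv]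
  rw [dotProduct_comm, Matrix.dotProduct_mulVec, Matrix.mulVec_transpose, dotProduct_comm]

theorem neg_sq_div_four_le_inner_add {E : Type*} [NormedAddCommGroup E] [InnerProductSpace ℝ E]
    (w v : E) {d : ℝ} (hv : ‖v‖ ≤ d) : -(d ^ 2 / 4) ≤ ⟪w, w + v⟫ := by
  rw [inner_add_right, real_inner_self_eq_norm_sq]
  have h₁ : -(‖w‖ * ‖v‖) ≤ ⟪w, v⟫ := (abs_le.mp (abs_real_inner_le_norm w v)).1
  have h₂ := mul_le_mul_of_nonneg_left hv (norm_nonneg w)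
  nlinarith [sq_nonneg (‖w‖ - d / 2)]

/-- A function whose derivative is positive wherever its value lies below `L` stays above `L`
if it starts there. -/
theorem le_of_deriv_pos_below {h h' : ℝ → ℝ} {a L : ℝ}
    (hd : ∀ t ≥ a, HasDerivAt h (h' t) t) (hpos : ∀ t ≥ a, h t < L → 0 < h' t)
    (ha : L ≤ h a) {t : ℝ} (ht : a ≤ t) : L ≤ h t := by
  refine le_of_forall_pos_sub_le fun ε hε => ?_
  have key := image_le_of_deriv_right_lt_deriv_boundary (a := a) (b := t)
    (f := fun s => -h s) (f' := fun s => -h' s) (B := fun _ => ε - L) (B' := fun _ => 0)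
    (fun s hs => (hd s hs.1).neg.continuousAt.continuousWithinAt)
    (fun s hs => (hd s hs.1).neg.hasDerivWithinAt) (by linarith)
    (fun s => hasDerivAt_const s _)
    (fun s hs hsL => neg_neg_of_pos (hpos s hs.1 (by linarith)))
    (Set.right_mem_Icc.mpr ht)
  linarith

/-- Theorem 1 combined with Lemma 1: along any closed-loop trajectory of
`ẋ = f(x) + g(x)(u_s + g(x)ᵀ∇b(x) + μ)` with RCBF gain, bounded disturbance `‖μ(t)‖ ≤ d̄` and
pointwise nominal barrier condition, the state stays in the enlarged safe set
`{x : b(x) ≥ L}` where `α(L) = -d̄²/4`. -/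
theorem stmt_6 (n m : ℕ) (hn : 0 < n) (hm : 0 < m)
    (b : EuclideanSpace ℝ (Fin n) → ℝ) (hb : ContDiff ℝ 1 b)
    (f : EuclideanSpace ℝ (Fin n) → EuclideanSpace ℝ (Fin n)) (hf : Continuous f)
    (g : EuclideanSpace ℝ (Fin n) → Matrix (Fin n) (Fin m) ℝ) (hg : Continuous g)
    (α : ℝ → ℝ) (hlip : LocallyLipschitz α) (hmono : StrictMono α) (hα0 : α 0 = 0)
    (dbar : ℝ) (hdbar : 0 ≤ dbar)
    (x : ℝ → EuclideanSpace ℝ (Fin n)) (us μ : ℝ → EuclideanSpace ℝ (Fin m))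
    (hμ : ∀ t ≥ (0 : ℝ), ‖μ t‖ ≤ dbar)
    (hx : ∀ t ≥ (0 : ℝ), HasDerivAt x
      (f (x t) + matVec (g (x t)) (us t + matVecT (g (x t)) (gradient b (x t)) + μ t)) t)
    (hbar : ∀ t ≥ (0 : ℝ),
      ⟪gradient b (x t), f (x t)⟫ + ⟪matVecT (g (x t)) (gradient b (x t)), us t⟫
        ≥ -α (b (x t)))
    (L : ℝ) (hL : L ≤ 0) (hαL : α L = -(dbar ^ 2 / 4))
    (hinit : b (x 0) ≥ L) :
    ∀ t ≥ (0 : ℝ), b (x t) ≥ L := by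
  have hd (t : ℝ) (ht : t ≥ 0) := ((hb.differentiable one_ne_zero
    (x t)).hasGradientAt.hasFDerivAt.comp_hasDerivAt t (hx t ht))
  intro t ht
  refine le_of_deriv_pos_below hd (fun s hs hsL => ?_) hinit ht
  have hα : α (b (x s)) < α L := hmono hsL
  have hdist := neg_sq_div_four_le_inner_add
    (matVecT (g (x s)) (gradient b (x s))) (μ s) (hμ s hs)
  have hnom := hbar s hs
  rw [InnerProductSpace.toDual_apply_apply, inner_add_right, inner_matVec, add_assoc,
    inner_add_right]
  linarith
end
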